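/- Let n be a nonnegative integer and a, b, c, d, q ∈ ℂ. Set λ = 1+2a−b−c−d and w = 1+2a−2λ−n. Assume 2q − a ≠ 0, set α = q(2λ−a)/(2q−a), and let δ ∈ ℂ satisfy δ² = λ²/4 − (q(2λ−a)+n(2q−a))/2. Assume the parameters are nondegenerate for the identity below. Then ₆F₅(a, b, c, d, q+1, −n; 1+a−b, 1+a−c, 1+a−d, q, w; 1) = [ (2λ−a)_n (λ−a)_n (α+1)_n / ( (1+λ)_n (2λ−2a)_n (α)_n ) ] · ₁₁F₁₀(λ, 1+λ/2, a/2, (a+1)/2, λ+b−a, λ+c−a, λ+d−a, 1+a−w, λ/2−δ+1, λ/2+δ+1, −n; λ/2, (2+2λ−a)/2, (1+2λ−a)/2, 1+a−b, 1+a−c, 1+a−d, λ+w−a, λ/2+δ, λ/2−δ, 1+λ+n; 1). -/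

import Mathlib

/-- Rising factorial (Pochhammer symbol) `(a)ₖ = a(a+1)⋯(a+k−1)`. -/
noncomputable def poch (a : ℂ) (k : ℕ) : ℂ := (ascPochhammer ℂ k).eval a

/-- Terminating hypergeometric sum with numerator parameters `A` together with
the extra top parameter `-n`, denominator parameters `B`, and argument `x`. -/
noncomputable def hypTerm (A B : List ℂ) (n : ℕ) (x : ℂ) : ℂ :=
  ∑ k ∈ Finset.range (n + 1),
    ((A.map fun a => poch a k).prod * poch (-(n : ℂ)) k) /
      ((k.factorial : ℂ) * (B.map fun b => poch b k).prod) * x ^ k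

theorem poch_zero (a : ℂ) : poch a 0 = 1 := by simp [poch]

theorem poch_succ (a : ℂ) (k : ℕ) : poch a (k + 1) = poch a k * (a + k) := by
  simp [poch, ascPochhammer_succ_eval]

theorem poch_add (a : ℂ) (k m : ℕ) : poch a (k + m) = poch a k * poch (a + k) m := by
  induction m with
  | zero => simp [poch_zero]
  | succ m ih =>
    rw [← add_assoc, poch_succ, poch_succ, ih]
    push_cast
    ring

theorem poch_succ_left (a : ℂ) (k : ℕ) : poch a (k + 1) = a * poch (a + 1) k := by
  rw [add_comm k 1, poch_add]
  simp [poch_succ, poch_zero]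

theorem poch_ne_zero_of_le {a : ℂ} {k m : ℕ} (h : poch a m ≠ 0) (hkm : k ≤ m) :
    poch a k ≠ 0 := by
  obtain ⟨l, rfl⟩ := Nat.exists_eq_add_of_le hkm
  rw [poch_add] at h
  exact left_ne_zero_of_mul h

/-- Reversing the order of the factors in a rising factorial. -/
theorem poch_reverse (z : ℂ) (k : ℕ) : poch (1 - k - z) k = (-1) ^ k * poch z k := by
  induction k generalizing z with
  | zero => simp [poch_zero]
  | succ k ih =>
    rw [poch_succ, poch_succ_left z, show (1 - ((k + 1 : ℕ) : ℂ) - z) = 1 - k - (z + 1) by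
      push_cast; ring, ih]
    ring

theorem poch_reverse_mul (F : ℂ) (k m : ℕ) :
    poch (1 - ((k + m : ℕ) : ℂ) - F) k * poch F m = (-1) ^ k * poch F (k + m) := by
  rw [show (1 - ((k + m : ℕ) : ℂ) - F) = 1 - k - (F + m) by push_cast; ring, poch_reverse,
    add_comm k m, poch_add]
  ring

theorem poch_one (k : ℕ) : poch 1 k = k.factorial := by
  simp [poch]

theorem poch_neg_mul_factorial (k m : ℕ) :
    poch (-((k + m : ℕ) : ℂ)) k * m.factorial = (-1) ^ k * (k + m).factorial := by
  have h := poch_reverse_mul 1 k m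
  rw [poch_one, poch_one] at h
  rw [← h]
  congr 2
  ring

theorem poch_shift (a : ℂ) (k : ℕ) : a * poch (a + 1) k = poch a k * (a + k) := by
  rw [← poch_succ_left, poch_succ]

theorem poch_two_mul (a : ℂ) (k : ℕ) :
    poch a (2 * k) = 4 ^ k * poch (a / 2) k * poch ((a + 1) / 2) k := by
  induction k with
  | zero => simp [poch_zero]
  | succ k ih =>
    rw [show 2 * (k + 1) = 2 * k + 1 + 1 by ring, poch_succ, poch_succ, poch_succ, poch_succ, ih]
    push_cast
    ring

/-- The Pfaff–Saalschütz sum, with the denominator parameter involving `N` reversed. -/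
theorem saalschutz (A B E : ℂ) (N : ℕ) (hE : poch E N ≠ 0) :
    ∑ m ∈ Finset.range (N + 1), poch A m * poch B m * poch (E - A - B) (N - m) /
        (m.factorial * (N - m).factorial * poch E m)
      = poch (E - A) N * poch (E - B) N / (N.factorial * poch E N) := by
  induction N with
  | zero => simp [poch_zero]
  | succ N ih =>
    have hEN : poch E N ≠ 0 := poch_ne_zero_of_le hE N.le_succ
    have partialSum : ∀ M ≤ N, ∑ m ∈ Finset.range (M + 1),
        ((N + 1) * (E + N) * (poch A m * poch B m * poch (E - A - B) (N + 1 - m) /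
          (m.factorial * (N + 1 - m).factorial * poch E m))
        - (E - A + N) * (E - B + N) * (poch A m * poch B m * poch (E - A - B) (N - m) /
          (m.factorial * (N - m).factorial * poch E m)))
        = - (poch A (M + 1) * poch B (M + 1) * poch (E - A - B) (N - M) /
          (M.factorial * (N - M).factorial * poch E M)) := by
      intro M hM
      induction M with
      | zero =>
        simp only [zero_add, Finset.sum_range_one, Nat.sub_zero, poch_succ, poch_zero,
          Nat.factorial_succ]
        have := Nat.cast_ne_zero (R := ℂ).2 N.factorial_ne_zero
        have : (N : ℂ) + 1 ≠ 0 := by exact_mod_cast N.succ_ne_zero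
        push_cast
        field_simp
        ring
      | succ M ihM =>
        rw [Finset.sum_range_succ, ihM (by omega)]
        have hEM : poch E (M + 1) ≠ 0 := poch_ne_zero_of_le hEN hM
        obtain ⟨l, rfl⟩ := Nat.exists_eq_add_of_le hM
        rw [show M + 1 + l + 1 - (M + 1) = l + 1 by omega, show M + 1 + l - (M + 1) = l by omega,
          show M + 1 + l - M = l + 1 by omega]
        rw [poch_succ] at hEM
        have h1 := left_ne_zero_of_mul hEM
        have h2 := right_ne_zero_of_mul hEM
        have h3 := Nat.cast_ne_zero (R := ℂ).2 M.factorial_ne_zero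
        have h4 := Nat.cast_ne_zero (R := ℂ).2 l.factorial_ne_zero
        have h5 : (M : ℂ) + 1 ≠ 0 := by exact_mod_cast M.succ_ne_zero
        have h6 : (l : ℂ) + 1 ≠ 0 := by exact_mod_cast l.succ_ne_zero
        simp only [poch_succ, Nat.factorial_succ]
        push_cast
        field_simp
        ring
    have key := partialSum N le_rfl
    rw [Finset.sum_sub_distrib, ← Finset.mul_sum, ← Finset.mul_sum, ih hEN] at key
    rw [Finset.sum_range_succ]
    rw [poch_succ] at hE
    have h2 := right_ne_zero_of_mul hE
    have h3 := Nat.cast_ne_zero (R := ℂ).2 N.factorial_ne_zero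
    have h5 : (N : ℂ) + 1 ≠ 0 := by exact_mod_cast N.succ_ne_zero
    apply mul_left_cancel₀ (mul_ne_zero h5 h2)
    rw [mul_add, eq_add_of_sub_eq key]
    simp only [Nat.sub_self, poch_succ, poch_zero, Nat.factorial_succ, Nat.factorial_zero]
    push_cast
    field_simp
    ring

/-- One step of the telescoping certificate in the proof of Dougall's sum. -/
theorem dougall_telescope {κ L b c d p u A z l f b₁ b₂ c₁ c₂ d₁ d₂ m₁ g Q w P r s k₁ J₁ y₀ y₁
      t₁ t₂ t₃ t₄ : ℂ} (hQ : Q ≠ 0) (hw : w ≠ 0) (hb₂ : b₂ ≠ 0) (hc₂ : c₂ ≠ 0) (hd₂ : d₂ ≠ 0)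
    (hJ₁ : J₁ ≠ 0) (hm₁ : m₁ ≠ 0)
    (h : P * s * y₁ * k₁ * z - r * s * y₀ * m₁ * w
      = κ * (z * b₂ * c₂ * d₂ * J₁ * w - t₁ * t₂ * t₃ * t₄ * y₁ * m₁)) :
    -(κ * L * b * c * d * p * u * (A * z) / (l * f * b₁ * c₁ * d₁ * (m₁ * g) * Q)) +
      (P * (L * s * b * c * d * (p * y₁) * (k₁ * u) * (A * z) /
        (l * (J₁ * f) * (b₁ * b₂) * (c₁ * c₂) * (d₁ * d₂) * (m₁ * g) * (Q * w))) -
      r * (L * s * b * c * d * (y₀ * p) * u * A /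
        (l * (J₁ * f) * (b₁ * b₂) * (c₁ * c₂) * (d₁ * d₂) * g * Q)))
      = -(κ * (L * t₁) * (b * t₂) * (c * t₃) * (d * t₄) * (p * y₁) * u * A /
        (l * (J₁ * f) * (b₁ * b₂) * (c₁ * c₂) * (d₁ * d₂) * g * (Q * w))) := by
  have e₁ : (1 : ℂ) / (l * f * b₁ * c₁ * d₁ * (m₁ * g) * Q) = (b₂ * c₂ * d₂ * J₁ * w) /
      (l * (J₁ * f) * (b₁ * b₂) * (c₁ * c₂) * (d₁ * d₂) * (m₁ * g) * (Q * w)) := by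
    field_simp
  have e₂ : (1 : ℂ) / (l * (J₁ * f) * (b₁ * b₂) * (c₁ * c₂) * (d₁ * d₂) * g * Q) = (m₁ * w) /
      (l * (J₁ * f) * (b₁ * b₂) * (c₁ * c₂) * (d₁ * d₂) * (m₁ * g) * (Q * w)) := by
    field_simp
  have e₃ : (1 : ℂ) / (l * (J₁ * f) * (b₁ * b₂) * (c₁ * c₂) * (d₁ * d₂) * g * (Q * w)) = m₁ /
      (l * (J₁ * f) * (b₁ * b₂) * (c₁ * c₂) * (d₁ * d₂) * (m₁ * g) * (Q * w)) := by
    field_simp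
  rw [← mul_one_div (κ * L * b * c * d * p * u * (A * z)), e₁,
    ← mul_one_div (L * s * b * c * d * (y₀ * p) * u * A), e₂,
    ← mul_one_div (κ * (L * t₁) * (b * t₂) * (c * t₃) * (d * t₄) * (p * y₁) * u * A), e₃]
  linear_combination (L * b * c * d * p * u * A /
    (l * (J₁ * f) * (b₁ * b₂) * (c₁ * c₂) * (d₁ * d₂) * (m₁ * g) * (Q * w))) * h

set_option maxHeartbeats 1000000 in
/-- Dougall's two-balanced very-well-poised `₇F₆` sum, cleared of the denominators which are not
needed to be nonzero. -/
theorem dougall (l B C D a : ℂ) (ha : a = 1 + 2 * l - B - C - D) (k : ℕ) (hl : l ≠ 0)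
    (hB : poch (1 + l - B) k ≠ 0) (hC : poch (1 + l - C) k ≠ 0) (hD : poch (1 + l - D) k ≠ 0)
    (hlk : poch (1 + l) (2 * k) ≠ 0) :
    ∑ j ∈ Finset.range (k + 1), poch l j * (l + 2 * j) * poch B j * poch C j * poch D j *
        poch (a + k) j * k.factorial * poch (a - l) (k - j) /
        (l * j.factorial * poch (1 + l - B) j * poch (1 + l - C) j * poch (1 + l - D) j *
          (k - j).factorial * poch (1 + l) (k + j))
      = poch (1 + l - C - D) k * poch (1 + l - B - D) k * poch (1 + l - B - C) k /
        (poch (1 + l - B) k * poch (1 + l - C) k * poch (1 + l - D) k) := by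
  induction k with
  | zero => simp [poch_zero, hl]
  | succ k ih =>
    have hBk := poch_ne_zero_of_le hB k.le_succ
    have hCk := poch_ne_zero_of_le hC k.le_succ
    have hDk := poch_ne_zero_of_le hD k.le_succ
    have partialSum : ∀ J ≤ k, ∑ j ∈ Finset.range (J + 1),
        ((1 + l - B + k) * (1 + l - C + k) * (1 + l - D + k) *
          (poch l j * (l + 2 * j) * poch B j * poch C j * poch D j *
          poch (a + (k + 1 : ℕ)) j * (k + 1).factorial * poch (a - l) (k + 1 - j) /
          (l * j.factorial * poch (1 + l - B) j * poch (1 + l - C) j * poch (1 + l - D) j *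
            (k + 1 - j).factorial * poch (1 + l) (k + 1 + j)))
        - (1 + l - C - D + k) * (1 + l - B - D + k) * (1 + l - B - C + k) *
          (poch l j * (l + 2 * j) * poch B j * poch C j * poch D j *
          poch (a + k) j * k.factorial * poch (a - l) (k - j) /
          (l * j.factorial * poch (1 + l - B) j * poch (1 + l - C) j * poch (1 + l - D) j *
            (k - j).factorial * poch (1 + l) (k + j))))
        = - ((a + 2 * k + 1) * poch l (J + 1) * poch B (J + 1) * poch C (J + 1) *
          poch D (J + 1) * poch (a + k + 1) J * k.factorial * poch (a - l) (k - J) /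
          (l * J.factorial * poch (1 + l - B) J * poch (1 + l - C) J * poch (1 + l - D) J *
            (k - J).factorial * poch (1 + l) (k + J + 1))) := by
      intro J hJ
      induction J with
      | zero =>
        have hlk' : poch (1 + l) (k + 1) ≠ 0 := poch_ne_zero_of_le hlk (by omega)
        rw [poch_succ] at hlk'
        have h1 := left_ne_zero_of_mul hlk'
        have h2 := right_ne_zero_of_mul hlk'
        have h3 := Nat.cast_ne_zero (R := ℂ).2 k.factorial_ne_zero
        have h4 : (k : ℂ) + 1 ≠ 0 := by exact_mod_cast k.succ_ne_zero
        simp only [zero_add, Finset.sum_range_one, Nat.sub_zero, poch_succ, poch_zero,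
          Nat.factorial_succ, Nat.factorial_zero, add_zero]
        push_cast
        field_simp
        subst ha
        ring
      | succ J ihJ =>
        rw [Finset.sum_range_succ, ihJ (by omega)]
        have hBJ : poch (1 + l - B) (J + 1) ≠ 0 := poch_ne_zero_of_le hBk hJ
        have hCJ : poch (1 + l - C) (J + 1) ≠ 0 := poch_ne_zero_of_le hCk hJ
        have hDJ : poch (1 + l - D) (J + 1) ≠ 0 := poch_ne_zero_of_le hDk hJ
        have hlJ : poch (1 + l) (k + J + 1 + 1) ≠ 0 := poch_ne_zero_of_le hlk (by omega)
        rw [poch_succ] at hBJ hCJ hDJ hlJ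
        rw [← add_assoc k J 1, show k + 1 + (J + 1) = k + J + 1 + 1 by omega, poch_succ (1 + l) (k + J + 1)]
        generalize hQ : poch (1 + l) (k + J + 1) = Q at *
        have hl1 := left_ne_zero_of_mul hlJ
        have hl2 := right_ne_zero_of_mul hlJ
        obtain ⟨m, rfl⟩ := Nat.exists_eq_add_of_le hJ
        rw [show J + 1 + m + 1 - (J + 1) = m + 1 by omega, show J + 1 + m - (J + 1) = m by omega,
          show J + 1 + m - J = m + 1 by omega]
        have hB2 := right_ne_zero_of_mul hBJ
        have hC2 := right_ne_zero_of_mul hCJ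
        have hD2 := right_ne_zero_of_mul hDJ
        rw [poch_succ_left (a + (J + 1 + m : ℕ)) J, Nat.cast_succ (J + 1 + m), ← add_assoc a,
          poch_succ (a + (J + 1 + m : ℕ) + 1) J, poch_succ (a - l) m, poch_succ (1 + l - B) J,
          poch_succ (1 + l - C) J, poch_succ (1 + l - D) J, Nat.factorial_succ (J + 1 + m),
          Nat.factorial_succ J, Nat.factorial_succ m, poch_succ l (J + 1), poch_succ B (J + 1),
          poch_succ C (J + 1), poch_succ D (J + 1)]
        simp only [Nat.cast_mul]
        refine dougall_telescope hl1 hl2 hB2 hC2 hD2 (Nat.cast_ne_zero.2 J.succ_ne_zero)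
          (Nat.cast_ne_zero.2 m.succ_ne_zero) ?_
        push_cast
        subst ha
        ring
    have key := partialSum k le_rfl
    rw [Finset.sum_sub_distrib, ← Finset.mul_sum, ← Finset.mul_sum,
      ih hBk hCk hDk (poch_ne_zero_of_le hlk (by omega))] at key
    rw [Finset.sum_range_succ]
    rw [show 2 * (k + 1) = k + k + 1 + 1 by ring, poch_succ] at hlk
    rw [poch_succ] at hB hC hD
    have hl1 := left_ne_zero_of_mul hlk
    have hl2 := right_ne_zero_of_mul hlk
    have hB2 := right_ne_zero_of_mul hB
    have hC2 := right_ne_zero_of_mul hC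
    have hD2 := right_ne_zero_of_mul hD
    have h3 := Nat.cast_ne_zero (R := ℂ).2 k.factorial_ne_zero
    have h5 : (k : ℂ) + 1 ≠ 0 := by exact_mod_cast k.succ_ne_zero
    have boundary : (1 + l - B + k) * (1 + l - C + k) * (1 + l - D + k) *
          (poch l (k + 1) * (l + 2 * (k + 1 : ℕ)) * poch B (k + 1) * poch C (k + 1) *
          poch D (k + 1) * poch (a + (k + 1 : ℕ)) (k + 1) * (k + 1).factorial *
          poch (a - l) (k + 1 - (k + 1)) /
          (l * (k + 1).factorial * poch (1 + l - B) (k + 1) * poch (1 + l - C) (k + 1) *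
            poch (1 + l - D) (k + 1) * (k + 1 - (k + 1)).factorial *
            poch (1 + l) (k + 1 + (k + 1))))
        = (a + 2 * k + 1) * poch l (k + 1) * poch B (k + 1) * poch C (k + 1) *
          poch D (k + 1) * poch (a + k + 1) k * k.factorial * poch (a - l) (k - k) /
          (l * k.factorial * poch (1 + l - B) k * poch (1 + l - C) k * poch (1 + l - D) k *
            (k - k).factorial * poch (1 + l) (k + k + 1)) := by
      rw [show k + 1 + (k + 1) = k + k + 1 + 1 by ring, poch_succ (1 + l) (k + k + 1),
        poch_succ (a + (k + 1 : ℕ)), Nat.cast_succ k, ← add_assoc a]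
      generalize poch l (k + 1) = x1
      generalize poch B (k + 1) = x2
      generalize poch C (k + 1) = x3
      generalize poch D (k + 1) = x4
      generalize poch (a + k + 1) k = x5
      simp only [Nat.sub_self, poch_succ (1 + l - B), poch_succ (1 + l - C),
        poch_succ (1 + l - D), poch_zero, Nat.factorial_succ, Nat.factorial_zero]
      generalize poch (1 + l) (k + k + 1) = Q at *
      push_cast at hl2 ⊢
      rw [show (1 : ℂ) + l + (k + k + 1) = l + 2 * (k + 1) by ring] at hl2 ⊢
      field_simp
      ring
    apply mul_left_cancel₀ (mul_ne_zero (mul_ne_zero hB2 hC2) hD2)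
    rw [mul_add, eq_add_of_sub_eq key, boundary, neg_add_cancel_comm]
    simp only [poch_succ _ k]
    field_simp

/-- A well-poised `₃F₂` sum with an additional linear factor. -/
theorem sum_linear_factor (A B x : ℂ) (N : ℕ) (hE : poch (A - B) (N + 1) ≠ 0) :
    (A - 2 * B) * ∑ m ∈ Finset.range (N + 1), poch A m * poch B m * poch (-2 * B) (N - m) /
        (m.factorial * (N - m).factorial * poch (1 + A - B) m) * (x + m)
      = poch (-B) N * poch (A - 2 * B) N / (N.factorial * poch (1 + A - B) N) *
        (x * (A - 2 * B + 2 * N) - N * A) := by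
  have h0 : A - B ≠ 0 := by
    rw [poch_succ_left] at hE
    exact left_ne_zero_of_mul hE
  have hN : A - B + N ≠ 0 := by
    rw [poch_succ] at hE
    exact right_ne_zero_of_mul hE
  have hE' : poch (1 + A - B) N ≠ 0 := by
    rw [poch_succ_left, show A - B + 1 = 1 + A - B by ring] at hE
    exact right_ne_zero_of_mul hE
  have sum_shifted : ∑ m ∈ Finset.range (N + 1), poch A m * poch B m * poch (-2 * B) (N - m) /
        (m.factorial * (N - m).factorial * poch (1 + A - B) m) * (A - B + m)
      = (A - B + N) * poch (-B) N * poch (A - 2 * B) N / (N.factorial * poch (1 + A - B) N) := by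
    have hs := saalschutz A B (A - B) N (poch_ne_zero_of_le hE N.le_succ)
    have conv : ∀ m ≤ N, (A - B) / poch (A - B) m = (A - B + m) / poch (1 + A - B) m := by
      intro m hm
      have := poch_shift (A - B) m
      rw [show A - B + 1 = 1 + A - B by ring] at this
      rw [div_eq_div_iff (poch_ne_zero_of_le hE (by omega)) (poch_ne_zero_of_le hE' hm), this]
      ring
    rw [show A - B - A - B = -2 * B by ring, show A - B - A = -B by ring,
      show A - B - B = A - 2 * B by ring] at hs
    have hs' := congrArg (fun t => (A - B) * t) hs
    simp only [Finset.mul_sum] at hs'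
    calc _ = _ := Finset.sum_congr rfl fun m hm => ?_
      _ = _ := hs'
      _ = _ := ?_
    · have := conv m (by simpa [Nat.lt_succ_iff] using hm)
      linear_combination (-(poch A m * poch B m * poch (-2 * B) (N - m) /
        (m.factorial * (N - m).factorial))) * this
    · linear_combination (poch (-B) N * poch (A - 2 * B) N / N.factorial) * conv N le_rfl
  have sum_reversed_eq : ∑ m ∈ Finset.range (N + 1), poch A m * poch B m * poch (-2 * B) (N - m) /
        (m.factorial * (N - m).factorial * poch (1 + A - B) m) * (N - m)
      = (-2 * B) * ∑ m ∈ Finset.range N, poch A m * poch B m * poch (1 - 2 * B) (N - 1 - m) /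
        (m.factorial * (N - 1 - m).factorial * poch (1 + A - B) m) := by
    rw [Finset.sum_range_succ, sub_self, mul_zero, add_zero, Finset.mul_sum]
    refine Finset.sum_congr rfl fun m hm => ?_
    obtain ⟨l, rfl⟩ := Nat.exists_eq_add_of_lt (Finset.mem_range.1 hm)
    rw [show m + l + 1 - m = l + 1 by omega, show m + l + 1 - 1 - m = l by omega, poch_succ_left,
      Nat.factorial_succ, show -2 * B + 1 = 1 - 2 * B by ring]
    have h6 : (l : ℂ) + 1 ≠ 0 := by exact_mod_cast l.succ_ne_zero
    push_cast
    field_simp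
    ring
  have sum_reversed : (A - 2 * B) * ∑ m ∈ Finset.range (N + 1),
        poch A m * poch B m * poch (-2 * B) (N - m) /
        (m.factorial * (N - m).factorial * poch (1 + A - B) m) * (N - m)
      = 2 * N * (A - B + N) * (poch (-B) N * poch (A - 2 * B) N /
        (N.factorial * poch (1 + A - B) N)) := by
    rw [sum_reversed_eq]
    cases N with
    | zero => simp
    | succ N =>
      have hs := saalschutz A B (1 + A - B) N (poch_ne_zero_of_le hE' N.le_succ)
      rw [show 1 + A - B - A - B = 1 - 2 * B by ring, show 1 + A - B - A = -B + 1 by ring,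
        show 1 + A - B - B = A - 2 * B + 1 by ring] at hs
      rw [Nat.add_sub_cancel, hs, poch_succ_left (-B), poch_succ_left (A - 2 * B), poch_succ,
        Nat.factorial_succ]
      rw [poch_succ] at hE'
      have h1 := left_ne_zero_of_mul hE'
      have h2 := right_ne_zero_of_mul hE'
      have h3 := Nat.cast_ne_zero (R := ℂ).2 N.factorial_ne_zero
      have h6 : (N : ℂ) + 1 ≠ 0 := by exact_mod_cast N.succ_ne_zero
      push_cast
      field_simp
      ring
  apply mul_left_cancel₀ hN
  have split : (A - B + N) * ∑ m ∈ Finset.range (N + 1),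
        poch A m * poch B m * poch (-2 * B) (N - m) /
        (m.factorial * (N - m).factorial * poch (1 + A - B) m) * (x + m)
      = (x + N) * ∑ m ∈ Finset.range (N + 1), poch A m * poch B m * poch (-2 * B) (N - m) /
        (m.factorial * (N - m).factorial * poch (1 + A - B) m) * (A - B + m)
      + (x - (A - B)) * ∑ m ∈ Finset.range (N + 1), poch A m * poch B m * poch (-2 * B) (N - m) /
        (m.factorial * (N - m).factorial * poch (1 + A - B) m) * (N - m) := by
    simp only [Finset.mul_sum, ← Finset.sum_add_distrib]
    refine Finset.sum_congr rfl fun m _ => ?_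
    ring
  rw [sum_shifted] at split
  linear_combination (A - 2 * B) * split + (x - (A - B)) * sum_reversed

theorem sum_range_triangle {M : Type*} [AddCommMonoid M] (n : ℕ) (f : ℕ → ℕ → M) :
    ∑ k ∈ Finset.range (n + 1), ∑ j ∈ Finset.range (k + 1), f j k
      = ∑ j ∈ Finset.range (n + 1), ∑ m ∈ Finset.range (n - j + 1), f j (j + m) := by
  rw [Finset.sum_comm' (t' := Finset.range (n + 1)) (s' := fun j => Finset.Ico j (n + 1))
    (by intro x y; simp only [Finset.mem_range, Finset.mem_Ico]; omega)]
  refine Finset.sum_congr rfl fun j hj => ?_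
  rw [Finset.sum_Ico_eq_sum_range, Nat.sub_add_comm (Nat.lt_succ_iff.1 (Finset.mem_range.1 hj))]

theorem eq_of_eq_div_self_mul {F : Type*} [Field F] {u x y : F} (hu : u ≠ 0)
    (h : x = u / u * y) : x = y := by
  rw [h, div_self hu, one_mul]

/-- The well-poised part of the coefficients of the transformed series. -/
noncomputable def wellPoisedCoeff (a b c d l : ℂ) (j : ℕ) : ℂ :=
  poch l j * (l + 2 * j) * poch (l + b - a) j * poch (l + c - a) j * poch (l + d - a) j /
    (l * j.factorial * poch (1 + a - b) j * poch (1 + a - c) j * poch (1 + a - d) j)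

/-- Dougall's sum as an expansion of the general term of the left-hand series. -/
theorem expand_term (n k : ℕ) (a b c d l q : ℂ) (hl : l = 1 + 2 * a - b - c - d)
    (hk : k ≤ n) (hl0 : l ≠ 0) (hq : q ≠ 0)
    (hb : poch (1 + a - b) n ≠ 0) (hc : poch (1 + a - c) n ≠ 0) (hd : poch (1 + a - d) n ≠ 0)
    (hw : poch (1 + 2 * a - 2 * l - n) n ≠ 0) (hqn : poch q n ≠ 0)
    (hl2 : poch (1 + l) (n + n) ≠ 0) :
    q * poch (2 * l - 2 * a) n * (poch a k * poch b k * poch c k * poch d k * poch (q + 1) k *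
      poch (-(n : ℂ)) k / (k.factorial * (poch (1 + a - b) k * poch (1 + a - c) k *
      poch (1 + a - d) k * poch q k * poch (1 + 2 * a - 2 * l - n) k)))
      = ∑ j ∈ Finset.range (k + 1), wellPoisedCoeff a b c d l j * (poch a (k + j) *
        poch (a - l) (k - j) * poch (2 * l - 2 * a) (n - k) * n.factorial /
        ((k - j).factorial * (n - k).factorial * poch (1 + l) (k + j)) * (q + k)) := by
  have hD := dougall l (l + b - a) (l + c - a) (l + d - a) a (by rw [hl]; ring) k hl0
    (by rw [show 1 + l - (l + b - a) = 1 + a - b by ring]; exact poch_ne_zero_of_le hb hk)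
    (by rw [show 1 + l - (l + c - a) = 1 + a - c by ring]; exact poch_ne_zero_of_le hc hk)
    (by rw [show 1 + l - (l + d - a) = 1 + a - d by ring]; exact poch_ne_zero_of_le hd hk)
    (poch_ne_zero_of_le hl2 (by omega))
  rw [show 1 + l - (l + b - a) = 1 + a - b by ring, show 1 + l - (l + c - a) = 1 + a - c by ring,
    show 1 + l - (l + d - a) = 1 + a - d by ring,
    show 1 + a - c - (l + d - a) = b by rw [hl]; ring,
    show 1 + a - b - (l + d - a) = c by rw [hl]; ring,
    show 1 + a - b - (l + c - a) = d by rw [hl]; ring] at hD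
  have hqk : poch (q + 1) k / poch q k = (q + k) / q := by
    rw [div_eq_div_iff (poch_ne_zero_of_le hqn hk) hq, mul_comm, poch_shift, mul_comm]
  have hwk : poch (2 * l - 2 * a) n * poch (-(n : ℂ)) k / poch (1 + 2 * a - 2 * l - n) k
      = n.factorial * poch (2 * l - 2 * a) (n - k) / (n - k).factorial := by
    have hwk0 := poch_ne_zero_of_le hw hk
    obtain ⟨m, rfl⟩ := Nat.exists_eq_add_of_le hk
    rw [Nat.add_sub_cancel_left, div_eq_div_iff hwk0 (Nat.cast_ne_zero.2 m.factorial_ne_zero)]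
    have h1 := poch_reverse_mul (2 * l - 2 * a) k m
    have h2 := poch_neg_mul_factorial k m
    rw [show 1 - ((k + m : ℕ) : ℂ) - (2 * l - 2 * a) = 1 + 2 * a - 2 * l - (k + m : ℕ) by ring] at h1
    linear_combination poch (2 * l - 2 * a) (k + m) * h2 - (k + m).factorial * h1
  have hkf := Nat.cast_ne_zero (R := ℂ).2 k.factorial_ne_zero
  calc _ = q * poch a k / k.factorial * (poch (q + 1) k / poch q k) *
        (poch (2 * l - 2 * a) n * poch (-(n : ℂ)) k / poch (1 + 2 * a - 2 * l - n) k) *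
        (poch b k * poch c k * poch d k /
          (poch (1 + a - b) k * poch (1 + a - c) k * poch (1 + a - d) k)) := by ring
    _ = _ := by
      rw [hqk, hwk, ← hD, Finset.mul_sum]
      refine Finset.sum_congr rfl fun j _ => ?_
      rw [poch_add a k j, wellPoisedCoeff]
      generalize q + (k : ℂ) = y
      generalize (k.factorial : ℂ) = f at *
      refine eq_of_eq_div_self_mul (mul_ne_zero hq hkf) ?_
      ring

/-- The inner sum after the interchange of summations. -/
theorem sum_expanded_terms (j N : ℕ) (a l q : ℂ) (hl0 : l ≠ 0)
    (h2la : 2 * l - a + 2 * j ≠ 0) (hl2 : poch (1 + l) (2 * (j + N)) ≠ 0) :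
    ∑ m ∈ Finset.range (N + 1), poch a (j + m + j) * poch (a - l) m *
        poch (2 * l - 2 * a) (N - m) * (j + N).factorial /
        (m.factorial * (N - m).factorial * poch (1 + l) (j + m + j)) * (q + (j + m : ℕ))
      = poch a (2 * j) * (j + N).factorial * poch (l - a) N * poch (2 * l - a + 2 * j) N /
        (N.factorial * (2 * l - a + 2 * j) * poch (1 + l) (j + N + j)) *
        (q * (2 * l - a + 2 * (j + N : ℕ)) - (j + N : ℕ) * a + 2 * j * (l + j)) := by
  have hl2' : poch l (2 * (j + N) + 1) ≠ 0 := by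
    rw [poch_succ_left, add_comm l]
    exact mul_ne_zero hl0 hl2
  have hE : poch (a + 2 * j - (a - l)) (N + 1) ≠ 0 := by
    have h := poch_ne_zero_of_le hl2' (show 2 * j + (N + 1) ≤ 2 * (j + N) + 1 by omega)
    rw [poch_add] at h
    rw [show a + 2 * j - (a - l) = l + (2 * j : ℕ) by push_cast; ring]
    exact right_ne_zero_of_mul h
  have hs := sum_linear_factor (a + 2 * j) (a - l) (q + j) N hE
  rw [show a + 2 * j - 2 * (a - l) = 2 * l - a + 2 * j by ring,
    show -2 * (a - l) = 2 * l - 2 * a by ring, show -(a - l) = l - a by ring,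
    show 1 + (a + 2 * j) - (a - l) = 1 + l + 2 * j by ring] at hs
  apply mul_left_cancel₀ h2la
  have hsplit : ∀ m : ℕ, ∀ z : ℂ, poch z (j + m + j) = poch z (2 * j) * poch (z + 2 * j) m := by
    intro m z
    rw [show j + m + j = 2 * j + m by ring, poch_add]
    push_cast
    rfl
  calc _ = poch a (2 * j) * (j + N).factorial / poch (1 + l) (2 * j) *
        ((2 * l - a + 2 * j) * ∑ m ∈ Finset.range (N + 1), poch (a + 2 * j) m * poch (a - l) m *
          poch (2 * l - 2 * a) (N - m) /
          (m.factorial * (N - m).factorial * poch (1 + l + 2 * j) m) * (q + j + m)) := by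
        simp only [Finset.mul_sum]
        refine Finset.sum_congr rfl fun m _ => ?_
        rw [hsplit, hsplit]
        push_cast
        ring
    _ = _ := by
        have hX : (q + j) * (2 * l - a + 2 * j + 2 * N) - N * (a + 2 * j)
            = q * (2 * l - a + 2 * (j + N : ℕ)) - (j + N : ℕ) * a + 2 * j * (l + j) := by
          push_cast
          ring
        rw [hs, hsplit, hX]
        generalize 2 * l - a + 2 * (j : ℂ) = T at *
        field_simp

/-- The general term of the right-hand series in terms of `wellPoisedCoeff`. -/
theorem transformed_term (j N : ℕ) (a b c d l q α δ : ℂ) (hl0 : l ≠ 0) (hq : q ≠ 0)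
    (h2q : 2 * q - a ≠ 0) (h2la : 2 * l - a ≠ 0) (h2laj : 2 * l - a + 2 * j ≠ 0)
    (hα : α = q * (2 * l - a) / (2 * q - a))
    (hδ : δ ^ 2 = l ^ 2 / 4 - (q * (2 * l - a) + (j + N : ℕ) * (2 * q - a)) / 2)
    (hF : poch (2 * l - 2 * a) (j + N) ≠ 0) (hαn : poch α (j + N) ≠ 0)
    (hδ1 : l / 2 + δ ≠ 0) (hδ2 : l / 2 - δ ≠ 0)
    (hδ1j : poch (l / 2 + δ) j ≠ 0) (hδ2j : poch (l / 2 - δ) j ≠ 0)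
    (hl2 : poch (l / 2) j ≠ 0)
    (h1 : poch ((2 + 2 * l - a) / 2) j ≠ 0) (h2 : poch ((1 + 2 * l - a) / 2) j ≠ 0)
    (hw : poch (1 + a - l - (j + N : ℕ)) j ≠ 0) :
    q * poch (2 * l - 2 * a) (j + N) * (poch (2 * l - a) (j + N) * poch (l - a) (j + N) *
        poch (α + 1) (j + N) /
        (poch (1 + l) (j + N) * poch (2 * l - 2 * a) (j + N) * poch α (j + N)) *
      (poch l j * poch (1 + l / 2) j * poch (a / 2) j * poch ((a + 1) / 2) j *
        poch (l + b - a) j * poch (l + c - a) j * poch (l + d - a) j *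
        poch (2 * l - a + (j + N : ℕ)) j * poch (l / 2 - δ + 1) j * poch (l / 2 + δ + 1) j *
        poch (-((j + N : ℕ) : ℂ)) j /
        (j.factorial * (poch (l / 2) j * poch ((2 + 2 * l - a) / 2) j *
          poch ((1 + 2 * l - a) / 2) j * poch (1 + a - b) j * poch (1 + a - c) j *
          poch (1 + a - d) j * poch (1 + a - l - (j + N : ℕ)) j * poch (l / 2 + δ) j *
          poch (l / 2 - δ) j * poch (1 + l + (j + N : ℕ)) j))))
      = wellPoisedCoeff a b c d l j * (poch a (2 * j) * (j + N).factorial * poch (l - a) N *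
        poch (2 * l - a + 2 * j) N /
        (N.factorial * (2 * l - a + 2 * j) * poch (1 + l) (j + N + j)) *
        (q * (2 * l - a + 2 * (j + N : ℕ)) - (j + N : ℕ) * a + 2 * j * (l + j))) := by
  generalize hn : j + N = n at *
  have hNf := Nat.cast_ne_zero (R := ℂ).2 N.factorial_ne_zero
  have hX0 : q * (2 * l - a + 2 * n) - n * a = 2 * ((l / 2 + δ) * (l / 2 - δ)) := by
    linear_combination 2 * hδ
  have hX0ne : q * (2 * l - a + 2 * n) - n * a ≠ 0 := by
    rw [hX0]
    exact mul_ne_zero two_ne_zero (mul_ne_zero hδ1 hδ2)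
  have eα : poch (α + 1) n / poch α n
      = (q * (2 * l - a + 2 * n) - n * a) / (q * (2 * l - a)) := by
    rw [div_eq_div_iff hαn (mul_ne_zero hq h2la)]
    have hs := poch_shift α n
    have hα' : α * (2 * q - a) = q * (2 * l - a) := by
      rw [hα, div_mul_cancel₀ _ h2q]
    linear_combination (2 * q - a) * hs - (poch (α + 1) n - poch α n) * hα'
  have eδ : poch (l / 2 - δ + 1) j * poch (l / 2 + δ + 1) j /
        (poch (l / 2 + δ) j * poch (l / 2 - δ) j)
      = (q * (2 * l - a + 2 * n) - n * a + 2 * j * (l + j)) /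
        (q * (2 * l - a + 2 * n) - n * a) := by
    rw [div_eq_div_iff (mul_ne_zero hδ1j hδ2j) hX0ne]
    have hs1 := poch_shift (l / 2 + δ) j
    have hs2 := poch_shift (l / 2 - δ) j
    rw [hX0]
    linear_combination 2 * (l / 2 - δ) * poch (l / 2 - δ + 1) j * hs1 +
      2 * (poch (l / 2 + δ) j * (l / 2 + δ + j)) * hs2
  have el : poch (1 + l / 2) j / poch (l / 2) j = (l + 2 * j) / l := by
    rw [div_eq_div_iff hl2 hl0]
    have hs := poch_shift (l / 2) j
    rw [add_comm 1]
    linear_combination 2 * hs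
  have hd2 : poch (1 + 2 * l - a) (2 * j)
      = 4 ^ j * (poch ((2 + 2 * l - a) / 2) j * poch ((1 + 2 * l - a) / 2) j) := by
    rw [poch_two_mul, show (1 + 2 * l - a + 1) / 2 = (2 + 2 * l - a) / 2 by ring]
    ring
  have hd2ne : poch (1 + 2 * l - a) (2 * j) ≠ 0 := by
    rw [hd2]
    exact mul_ne_zero (pow_ne_zero j (by norm_num)) (mul_ne_zero h1 h2)
  have ea : poch (a / 2) j * poch ((a + 1) / 2) j /
        (poch ((2 + 2 * l - a) / 2) j * poch ((1 + 2 * l - a) / 2) j)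
      = poch a (2 * j) / poch (1 + 2 * l - a) (2 * j) := by
    rw [poch_two_mul a, hd2, mul_assoc, mul_div_mul_left _ _ (pow_ne_zero j (by norm_num))]
  have ew : poch (l - a) n * poch (-(n : ℂ)) j / poch (1 + a - l - n) j
      = n.factorial / N.factorial * poch (l - a) N := by
    rw [div_mul_eq_mul_div, div_eq_div_iff hw hNf]
    have hr1 := poch_reverse_mul (l - a) j N
    have hr2 := poch_neg_mul_factorial j N
    rw [hn, show 1 - (n : ℂ) - (l - a) = 1 + a - l - n by ring] at hr1
    rw [hn] at hr2
    linear_combination poch (l - a) n * hr2 - n.factorial * hr1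
  have e2 : poch (2 * l - a) n * poch (2 * l - a + n) j / poch (1 + 2 * l - a) (2 * j)
      = (2 * l - a) * poch (2 * l - a + 2 * j) N / (2 * l - a + 2 * j) := by
    rw [div_eq_div_iff hd2ne h2laj, ← poch_add, ← hn, show j + N + j = 2 * j + N by ring, poch_add]
    have hs := poch_shift (2 * l - a) (2 * j)
    rw [show 2 * l - a + 1 = 1 + 2 * l - a by ring] at hs
    push_cast at hs ⊢
    linear_combination -poch (2 * l - a + 2 * j) N * hs
  calc _ = q * (poch (2 * l - 2 * a) n / poch (2 * l - 2 * a) n) *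
        (poch (α + 1) n / poch α n) *
        (poch (l / 2 - δ + 1) j * poch (l / 2 + δ + 1) j /
          (poch (l / 2 + δ) j * poch (l / 2 - δ) j)) *
        (poch (1 + l / 2) j / poch (l / 2) j) *
        ((poch (2 * l - a) n * poch (2 * l - a + n) j) * (poch (a / 2) j * poch ((a + 1) / 2) j /
          (poch ((2 + 2 * l - a) / 2) j * poch ((1 + 2 * l - a) / 2) j))) *
        (poch (l - a) n * poch (-(n : ℂ)) j / poch (1 + a - l - n) j) *
        (poch l j * poch (l + b - a) j * poch (l + c - a) j * poch (l + d - a) j /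
          (j.factorial * poch (1 + a - b) j * poch (1 + a - c) j * poch (1 + a - d) j)) /
        (poch (1 + l) n * poch (1 + l + n) j) := by ring
    _ = q * (poch (2 * l - 2 * a) n / poch (2 * l - 2 * a) n) *
        (poch (α + 1) n / poch α n) *
        (poch (l / 2 - δ + 1) j * poch (l / 2 + δ + 1) j /
          (poch (l / 2 + δ) j * poch (l / 2 - δ) j)) *
        (poch (1 + l / 2) j / poch (l / 2) j) *
        (poch a (2 * j) * (poch (2 * l - a) n * poch (2 * l - a + n) j /
          poch (1 + 2 * l - a) (2 * j))) *
        (poch (l - a) n * poch (-(n : ℂ)) j / poch (1 + a - l - n) j) *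
        (poch l j * poch (l + b - a) j * poch (l + c - a) j * poch (l + d - a) j /
          (j.factorial * poch (1 + a - b) j * poch (1 + a - c) j * poch (1 + a - d) j)) /
        poch (1 + l) (n + j) := by
      rw [ea, poch_add (1 + l) n j]
      ring
    _ = _ := by
      rw [eα, eδ, el, ew, e2, div_self hF, wellPoisedCoeff]
      generalize q * (2 * l - a + 2 * n) - n * a + 2 * j * (l + j) = Y
      generalize q * (2 * l - a + 2 * n) - n * a = X at *
      generalize 2 * l - a + 2 * (j : ℂ) = T at *
      generalize 2 * l - a = S at *
      generalize l + 2 * (j : ℂ) = R at *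
      refine eq_of_eq_div_self_mul (mul_ne_zero (mul_ne_zero hq hX0ne) h2la) ?_
      ring

theorem corollary_1C13P4 (n : ℕ) (a b c d q : ℂ)
    (lm w : ℂ) (hlm : lm = 1 + 2 * a - b - c - d) (hw : w = 1 + 2 * a - 2 * lm - (n : ℂ))
    (h2q : 2 * q - a ≠ 0)
    (α δ : ℂ)
    (hα : α = q * (2 * lm - a) / (2 * q - a))
    (hδ : δ ^ 2 = lm ^ 2 / 4 - (q * (2 * lm - a) + (n : ℂ) * (2 * q - a)) / 2)
    (hnd : ∀ z ∈ [1 + a - b, 1 + a - c, 1 + a - d, q, w,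
        lm / 2, (2 + 2 * lm - a) / 2, (1 + 2 * lm - a) / 2, lm + w - a,
        lm / 2 + δ, lm / 2 - δ, 1 + lm + (n : ℂ), 1 + lm, 2 * lm - 2 * a, α],
      ∀ k ≤ n, poch z k ≠ 0) :
    hypTerm [a, b, c, d, q + 1] [1 + a - b, 1 + a - c, 1 + a - d, q, w] n 1
      = poch (2 * lm - a) n * poch (lm - a) n * poch (α + 1) n /
          (poch (1 + lm) n * poch (2 * lm - 2 * a) n * poch α n) *
        hypTerm [lm, 1 + lm / 2, a / 2, (a + 1) / 2, lm + b - a, lm + c - a, lm + d - a,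
            1 + a - w, lm / 2 - δ + 1, lm / 2 + δ + 1]
          [lm / 2, (2 + 2 * lm - a) / 2, (1 + 2 * lm - a) / 2, 1 + a - b, 1 + a - c,
            1 + a - d, lm + w - a, lm / 2 + δ, lm / 2 - δ, 1 + lm + (n : ℂ)] n 1 := by
  rcases Nat.eq_zero_or_pos n with rfl | hn
  · simp [hypTerm, poch_zero]
  have ne : ∀ z ∈ [1 + a - b, 1 + a - c, 1 + a - d, q, w,
      lm / 2, (2 + 2 * lm - a) / 2, (1 + 2 * lm - a) / 2, lm + w - a,
      lm / 2 + δ, lm / 2 - δ, 1 + lm + (n : ℂ), 1 + lm, 2 * lm - 2 * a, α], z ≠ 0 := by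
    intro z hz
    simpa [poch_succ, poch_zero] using hnd z hz 1 hn
  simp only [List.forall_mem_cons] at hnd ne
  obtain ⟨hb, hc, hd, hq, hwn, hl2, h1, h2, hlw, hδ1, hδ2, hln, hl, hF, hαn, -⟩ := hnd
  obtain ⟨-, -, -, hq0, -, hl20, -, -, -, hδ10, hδ20, -, -, -, hα0, -⟩ := ne
  have hl0 : lm ≠ 0 := fun h => hl20 (by rw [h, zero_div])
  have h2la : 2 * lm - a ≠ 0 := fun h => hα0 (by rw [hα, h, mul_zero, zero_div])
  have h2laj : ∀ j ≤ n, 2 * lm - a + 2 * j ≠ 0 := by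
    intro j hj
    cases j with
    | zero => simpa using h2la
    | succ i =>
      have h := h1 (i + 1) hj
      rw [poch_succ] at h
      intro h'
      apply right_ne_zero_of_mul h
      push_cast at h'
      linear_combination h' / 2
  have hlnn : poch (1 + lm) (n + n) ≠ 0 := by
    rw [poch_add]
    exact mul_ne_zero (hl n le_rfl) (hln n le_rfl)
  apply mul_left_cancel₀ (mul_ne_zero hq0 (hF n le_rfl))
  calc _ = ∑ k ∈ Finset.range (n + 1), ∑ j ∈ Finset.range (k + 1),
        wellPoisedCoeff a b c d lm j * (poch a (k + j) *
        poch (a - lm) (k - j) * poch (2 * lm - 2 * a) (n - k) * n.factorial /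
        ((k - j).factorial * (n - k).factorial * poch (1 + lm) (k + j)) * (q + k)) := by
        rw [hypTerm, Finset.mul_sum]
        refine Finset.sum_congr rfl fun k hk => ?_
        subst hw
        rw [← expand_term n k a b c d lm q hlm (Nat.lt_succ_iff.1 (Finset.mem_range.1 hk)) hl0 hq0
          (hb n le_rfl) (hc n le_rfl) (hd n le_rfl) (hwn n le_rfl) (hq n le_rfl) hlnn]
        simp only [List.map_cons, List.map_nil, List.prod_cons, List.prod_nil, one_pow]
        ring
    _ = _ := by
        rw [sum_range_triangle, hypTerm, Finset.mul_sum, Finset.mul_sum]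
        refine Finset.sum_congr rfl fun j hj => ?_
        have hjn := Nat.lt_succ_iff.1 (Finset.mem_range.1 hj)
        have ht := h2laj j hjn
        obtain ⟨N, rfl⟩ := Nat.exists_eq_add_of_le hjn
        have hlw' : lm + w - a = 1 + a - lm - (j + N : ℕ) := by rw [hw]; ring
        rw [hlw'] at hlw
        have hT := transformed_term j N a b c d lm q α δ hl0 hq0 h2q h2la ht hα hδ (hF _ le_rfl)
          (hαn _ le_rfl) hδ10 hδ20 (hδ1 j hjn) (hδ2 j hjn) (hl2 j hjn) (h1 j hjn) (h2 j hjn)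
          (hlw j hjn)
        rw [← Finset.mul_sum, Nat.add_sub_cancel_left]
        simp only [Nat.add_sub_cancel_left, Nat.add_sub_add_left]
        rw [sum_expanded_terms j N a lm q hl0 ht (by rwa [two_mul]), ← hT, hlw',
          show 1 + a - w = 2 * lm - a + (j + N : ℕ) by rw [hw]; ring]
        simp only [List.map_cons, List.map_nil, List.prod_cons, List.prod_nil, one_pow]
        ring
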